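/- Let 𝒯 be a stubborn set assignment satisfying D0, D1 and D2. Then the full and reduced state spaces have exactly the same terminal states: a terminal state is reachable from ŝ if and only if it is reachable from ŝ along r-edges. -/

import Mathlib

/-- `TPath step s σ s'` means `s →[σ] s'`: firing the sequence `σ` of transitions
from `s` yields `s'`. -/
inductive TPath {S T : Type*} (step : S → T → S → Prop) : S → List T → S → Prop
  | nil (s : S) : TPath step s [] s
  | cons {s s' s'' : S} {t : T} {σ : List T} :
      step s t s' → TPath step s' σ s'' → TPath step s (t :: σ) s''

/-- Transition `t` is enabled at `s`. -/
def Enabled {S T : Type*} (step : S → T → S → Prop) (s : S) (t : T) : Prop :=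
  ∃ s', step s t s'

/-- A state is terminal iff no transition is enabled at it. -/
def Terminal {S T : Type*} (step : S → T → S → Prop) (s : S) : Prop :=
  ∀ t, ¬ Enabled step s t

/-- `s'` is reachable from `s`. -/
def Reachable {S T : Type*} (step : S → T → S → Prop) (s s' : S) : Prop :=
  ∃ σ, TPath step s σ s'

/-- An r-edge: a step `s →[t] s'` with `t ∈ 𝒯 s`. -/
def REdge {S T : Type*} (step : S → T → S → Prop) (𝒯 : S → Set T)
    (s : S) (t : T) (s' : S) : Prop :=
  step s t s' ∧ t ∈ 𝒯 s

/-- The transition relation is deterministic. -/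
def Deterministic {S T : Type*} (step : S → T → S → Prop) : Prop :=
  ∀ s t s₁ s₂, step s t s₁ → step s t s₂ → s₁ = s₂

/-- D0: if `s₀` is not terminal then `𝒯 s₀` contains an enabled transition. -/
def D0 {S T : Type*} (step : S → T → S → Prop) (𝒯 : S → Set T) : Prop :=
  ∀ s₀, ¬ Terminal step s₀ → ∃ t ∈ 𝒯 s₀, Enabled step s₀ t

/-- D1: if `t ∈ 𝒯 s₀`, `t₁,…,tₙ ∉ 𝒯 s₀` and `s₀ →[t₁⋯tₙ t] s'`
then `s₀ →[t t₁⋯tₙ] s'`. -/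
def D1 {S T : Type*} (step : S → T → S → Prop) (𝒯 : S → Set T) : Prop :=
  ∀ s₀ t σ s', t ∈ 𝒯 s₀ → (∀ u ∈ σ, u ∉ 𝒯 s₀) →
    TPath step s₀ (σ ++ [t]) s' → TPath step s₀ (t :: σ) s'

/-- D2: if `t ∈ 𝒯 s₀` is enabled at `s₀`, `t₁,…,tₙ ∉ 𝒯 s₀` and `s₀ →[t₁⋯tₙ] sₙ`
then `t` is enabled at `sₙ`. -/
def D2 {S T : Type*} (step : S → T → S → Prop) (𝒯 : S → Set T) : Prop :=
  ∀ s₀ t σ sₙ, t ∈ 𝒯 s₀ → Enabled step s₀ t → (∀ u ∈ σ, u ∉ 𝒯 s₀) →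
    TPath step s₀ σ sₙ → Enabled step sₙ t

theorem TPath.append {S T : Type*} {step : S → T → S → Prop} {s s' s'' : S} {σ τ : List T}
    (hσ : TPath step s σ s') (hτ : TPath step s' τ s'') : TPath step s (σ ++ τ) s'' := by
  induction hσ with
  | nil => exact hτ
  | cons h _ ih => exact .cons h (ih hτ)

theorem TPath.exists_of_append {S T : Type*} {step : S → T → S → Prop} {s s'' : S}
    {σ τ : List T} (h : TPath step s (σ ++ τ) s'') :
    ∃ s', TPath step s σ s' ∧ TPath step s' τ s'' := by
  induction σ generalizing s with
  | nil => exact ⟨s, .nil s, h⟩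
  | cons t σ ih =>
    cases h with
    | cons ht h =>
      obtain ⟨s', hσ, hτ⟩ := ih h
      exact ⟨s', .cons ht hσ, hτ⟩

theorem TPath.mono {S T : Type*} {step step' : S → T → S → Prop}
    (hle : ∀ s t s', step s t s' → step' s t s') {s s' : S} {σ : List T}
    (h : TPath step s σ s') : TPath step' s σ s' := by
  induction h with
  | nil s => exact .nil s
  | cons ht _ ih => exact .cons (hle _ _ _ ht) ih

theorem List.exists_eq_append_cons_of_exists_mem {α : Type*} {p : α → Prop} {l : List α}
    (h : ∃ x ∈ l, p x) : ∃ l₁ x l₂, l = l₁ ++ x :: l₂ ∧ p x ∧ ∀ y ∈ l₁, ¬ p y := by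
  induction l with
  | nil => simp at h
  | cons a l ih =>
    by_cases ha : p a
    · exact ⟨[], a, l, rfl, ha, by simp⟩
    · obtain ⟨l₁, x, l₂, rfl, hx, hl₁⟩ := ih (by simpa [ha] using h)
      exact ⟨a :: l₁, x, l₂, rfl, hx, by simpa [ha] using hl₁⟩

/-- A nonempty path to a terminal state contains a transition of the stubborn set of its source. -/
theorem TPath.exists_mem_stubborn {S T : Type*} {step : S → T → S → Prop} {𝒯 : S → Set T}
    (h0 : D0 step 𝒯) (h2 : D2 step 𝒯) {s s' : S} {t : T} {σ : List T}
    (h : TPath step s (t :: σ) s') (hs' : Terminal step s') : ∃ u ∈ t :: σ, u ∈ 𝒯 s := by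
  by_contra! hσ
  have hs : ¬ Terminal step s := by
    cases h with
    | cons ht _ => exact fun hs => hs t ⟨_, ht⟩
  obtain ⟨u, hu, hen⟩ := h0 s hs
  exact hs' u (h2 s u _ s' hu hen hσ h)

/-- A path to a terminal state can be permuted into a path of the reduced state space. -/
theorem TPath.reachable_rEdge {S T : Type*} {step : S → T → S → Prop} {𝒯 : S → Set T}
    (h0 : D0 step 𝒯) (h1 : D1 step 𝒯) (h2 : D2 step 𝒯) {s s' : S} {σ : List T}
    (h : TPath step s σ s') (hs' : Terminal step s') : Reachable (REdge step 𝒯) s s' := by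
  induction hn : σ.length generalizing s σ with
  | zero =>
    obtain rfl := List.length_eq_zero_iff.mp hn
    cases h
    exact ⟨[], .nil _⟩
  | succ n ih =>
    have hmem : ∃ u ∈ σ, u ∈ 𝒯 s := by
      cases σ with
      | nil => simp at hn
      | cons t σ => exact h.exists_mem_stubborn h0 h2 hs'
    obtain ⟨l₁, u, l₂, rfl, hu, hl₁⟩ := List.exists_eq_append_cons_of_exists_mem hmem
    rw [List.append_cons] at h
    obtain ⟨m, hm, hl₂⟩ := h.exists_of_append
    cases h1 s u l₁ m hu hl₁ hm with
    | cons hstep hl =>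
      obtain ⟨τ, hτ⟩ := ih (hl.append hl₂) (by simp at hn ⊢; omega)
      exact ⟨u :: τ, .cons ⟨hstep, hu⟩ hτ⟩

/-- The full and reduced state spaces have exactly the same terminal states:
a terminal state is reachable from `sHat` iff it is reachable from `sHat` along r-edges. -/
theorem stmt4 {S T : Type*} (step : S → T → S → Prop) (𝒯 : S → Set T) (sHat : S)
    (hdet : Deterministic step) (h0 : D0 step 𝒯) (h1 : D1 step 𝒯) (h2 : D2 step 𝒯) :
    ∀ s_t : S, Terminal step s_t →
      (Reachable step sHat s_t ↔ Reachable (REdge step 𝒯) sHat s_t) := by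
  intro s_t ht
  constructor
  · rintro ⟨σ, hσ⟩
    exact hσ.reachable_rEdge h0 h1 h2 ht
  · rintro ⟨σ, hσ⟩
    exact ⟨σ, hσ.mono fun _ _ _ h => h.1⟩
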